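/- Let G = G₁ + G₂i₂ and H = H₁ + H₂i₂ be bicomplex numbers, and let S := {z ∈ ℂ³ : −2G·z₁ + (1 − G²)·z₂ + (1 + G²)i₂·z₃ = 2H} (an equation in 𝔹, with z_k ∈ ℂ ⊆ 𝔹). Then: (i) if 𝒩(G) ≠ −1, S is an affine complex line {p + tw : t ∈ ℂ} whose direction vector w ∈ ℂ³ ∖ {0} satisfies w² ≠ 0 (a non-null line); (ii) if 𝒩(G) = −1, then S is nonempty if and only if H = c·G for some c ∈ ℂ, and in that case S = {z ∈ ℂ³ : z₁ + G₁z₂ + G₂z₃ = −c}, an affine complex 2-plane which is degenerate: the vector n = (1, G₁, G₂) is nonzero, satisfies n² = 0, and is both complex-normal to S and parallel to S. -/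

import Mathlib

noncomputable section

/-- Bicomplex multiplication on `𝔹 = ℂ × ℂ`. -/
def bmul (q w : ℂ × ℂ) : ℂ × ℂ := (q.1 * w.1 - q.2 * w.2, q.1 * w.2 + q.2 * w.1)

/-- Complex (square) norm of a bicomplex number. -/
def bN (q : ℂ × ℂ) : ℂ := q.1 ^ 2 + q.2 ^ 2

/-- The solution set of the Weierstrass congruence equation
`−2G z₁ + (1 − G²) z₂ + (1 + G²) i₂ z₃ = 2H` in `ℂ³`. -/
def Wset (G H : ℂ × ℂ) : Set (Fin 3 → ℂ) :=
  {z | bmul ((-2 : ℂ) • G) ((z 0), (0 : ℂ)) +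
       bmul (((1 : ℂ), (0 : ℂ)) - bmul G G) ((z 1), (0 : ℂ)) +
       bmul (bmul (((1 : ℂ), (0 : ℂ)) + bmul G G) ((0 : ℂ), (1 : ℂ))) ((z 2), (0 : ℂ))
         = (2 : ℂ) • H}

theorem mem_Wset_iff (G H : ℂ × ℂ) (z : Fin 3 → ℂ) :
    z ∈ Wset G H ↔
      -2 * G.1 * z 0 + (1 - G.1 ^ 2 + G.2 ^ 2) * z 1 - 2 * G.1 * G.2 * z 2 = 2 * H.1 ∧
      -2 * G.2 * z 0 - 2 * G.1 * G.2 * z 1 + (1 + G.1 ^ 2 - G.2 ^ 2) * z 2 = 2 * H.2 := by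
  simp only [Wset, bmul, Set.mem_ofPred_eq, Prod.ext_iff, Prod.fst_add, Prod.snd_add,
    Prod.fst_sub, Prod.snd_sub, Prod.smul_fst, Prod.smul_snd, smul_eq_mul]
  constructor <;> rintro ⟨h₁, h₂⟩ <;> constructor
  · linear_combination h₁
  · linear_combination h₂
  · linear_combination h₁
  · linear_combination h₂

/-- When `𝒩(G) ≠ −1` the two complex equations have orthogonal non-null normals, and the
solution set is a line directed by `(1 − 𝒩(G), 2G₁, 2G₂)`. -/
theorem Wset_eq_line {G : ℂ × ℂ} (H : ℂ × ℂ) (hG : bN G ≠ -1) :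
    ∃ (p w : Fin 3 → ℂ), w ≠ 0 ∧ (∑ k, w k ^ 2) ≠ 0 ∧
      Wset G H = {x : Fin 3 → ℂ | ∃ t : ℂ, x = p + t • w} := by
  obtain ⟨a, b⟩ := G
  obtain ⟨r, s⟩ := H
  have hN : 1 + a ^ 2 + b ^ 2 ≠ 0 := fun h => hG (by
    simp only [bN]
    linear_combination h)
  have hw : (∑ k, (![1 - a ^ 2 - b ^ 2, 2 * a, 2 * b] : Fin 3 → ℂ) k ^ 2) ≠ 0 := by
    have : (∑ k, (![1 - a ^ 2 - b ^ 2, 2 * a, 2 * b] : Fin 3 → ℂ) k ^ 2)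
        = (1 + a ^ 2 + b ^ 2) ^ 2 := by
      simp [Fin.sum_univ_three]
      ring
    rw [this]
    exact pow_ne_zero 2 hN
  refine ⟨![2 * (r * (-2 * a) + s * (-2 * b)) / (1 + a ^ 2 + b ^ 2) ^ 2,
      2 * (r * (1 - a ^ 2 + b ^ 2) + s * (-2 * a * b)) / (1 + a ^ 2 + b ^ 2) ^ 2,
      2 * (r * (-2 * a * b) + s * (1 + a ^ 2 - b ^ 2)) / (1 + a ^ 2 + b ^ 2) ^ 2],
    ![1 - a ^ 2 - b ^ 2, 2 * a, 2 * b], ?_, hw, ?_⟩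
  · intro h
    simp [h] at hw
  · ext z
    rw [mem_Wset_iff, Set.mem_ofPred_eq]
    constructor
    · rintro ⟨h₁, h₂⟩
      simp only at h₁ h₂
      refine ⟨((1 - a ^ 2 - b ^ 2) * z 0 + 2 * a * z 1 + 2 * b * z 2) /
        (1 + a ^ 2 + b ^ 2) ^ 2, ?_⟩
      ext k
      fin_cases k <;> simp <;> field_simp
      · linear_combination (-2 * a) * h₁ + (-2 * b) * h₂
      · linear_combination (1 - a ^ 2 + b ^ 2) * h₁ + (-2 * a * b) * h₂
      · linear_combination (-2 * a * b) * h₁ + (1 + a ^ 2 - b ^ 2) * h₂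
    · rintro ⟨t, rfl⟩
      constructor <;> simp <;> field_simp <;> ring

theorem mem_Wset_iff_of_bN_eq_neg_one {G : ℂ × ℂ} (H : ℂ × ℂ) (hG : bN G = -1)
    (z : Fin 3 → ℂ) :
    z ∈ Wset G H ↔ H = (-(z 0 + G.1 * z 1 + G.2 * z 2)) • G := by
  simp only [bN] at hG
  simp only [mem_Wset_iff, Prod.ext_iff, Prod.smul_fst, Prod.smul_snd, smul_eq_mul]
  constructor <;> rintro ⟨h₁, h₂⟩ <;> constructor
  · linear_combination (-1 / 2) * h₁ + (1 / 2) * z 1 * hG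
  · linear_combination (-1 / 2) * h₂ + (1 / 2) * z 2 * hG
  · linear_combination (-2) * h₁ + z 1 * hG
  · linear_combination (-2) * h₂ + z 2 * hG

theorem ne_zero_of_bN_eq_neg_one {G : ℂ × ℂ} (hG : bN G = -1) : G ≠ 0 := by
  rintro rfl
  simp [bN] at hG

theorem Wset_smul_eq_plane {G : ℂ × ℂ} (hG : bN G = -1) (c : ℂ) :
    Wset G (c • G) = {z : Fin 3 → ℂ | z 0 + G.1 * z 1 + G.2 * z 2 = -c} := by
  ext z
  rw [mem_Wset_iff_of_bN_eq_neg_one _ hG,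
    (smul_left_injective ℂ (ne_zero_of_bN_eq_neg_one hG)).eq_iff, Set.mem_ofPred_eq,
    eq_neg_iff_add_eq_zero, eq_neg_iff_add_eq_zero, add_comm]

/-- for `G, H ∈ 𝔹`, the congruence equation defines (i) a non-null
affine complex line when `𝒩(G) ≠ −1`, and (ii) when `𝒩(G) = −1`, it has solutions
iff `H` is a complex multiple `c·G` of `G`, in which case it defines the degenerate
affine complex 2-plane `z₁ + G₁z₂ + G₂z₃ = −c`, to which the null vector
`n = (1, G₁, G₂)` is both complex-normal and parallel. -/
theorem congruence_line_or_degenerate_plane (G H : ℂ × ℂ) :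
    (bN G ≠ -1 →
      ∃ (p w : Fin 3 → ℂ), w ≠ 0 ∧ (∑ k, w k ^ 2) ≠ 0 ∧
        Wset G H = {x : Fin 3 → ℂ | ∃ t : ℂ, x = p + t • w}) ∧
    (bN G = -1 →
      ((Wset G H).Nonempty ↔ ∃ c : ℂ, H = c • G) ∧
      ∀ c : ℂ, H = c • G →
        Wset G H = {z : Fin 3 → ℂ | z 0 + G.1 * z 1 + G.2 * z 2 = -c} ∧
        (![1, G.1, G.2] : Fin 3 → ℂ) ≠ 0 ∧
        (∑ k, (![1, G.1, G.2] : Fin 3 → ℂ) k ^ 2) = 0 ∧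
        (∀ z ∈ Wset G H, ∀ z' ∈ Wset G H,
          (∑ k, (![1, G.1, G.2] : Fin 3 → ℂ) k * (z k - z' k)) = 0) ∧
        (∀ z ∈ Wset G H, z + (![1, G.1, G.2] : Fin 3 → ℂ) ∈ Wset G H)) := by
  refine ⟨Wset_eq_line H, fun hG => ⟨⟨?_, ?_⟩, ?_⟩⟩
  · rintro ⟨z, hz⟩
    exact ⟨_, (mem_Wset_iff_of_bN_eq_neg_one H hG z).1 hz⟩
  · rintro ⟨c, rfl⟩
    refine ⟨![-c, 0, 0], ?_⟩
    simp [Wset_smul_eq_plane hG]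
  · rintro c rfl
    have hn : G.1 ^ 2 + G.2 ^ 2 = -1 := hG
    rw [Wset_smul_eq_plane hG]
    refine ⟨rfl, fun h => by simpa using congrFun h 0, ?_, fun z hz z' hz' => ?_, fun z hz => ?_⟩
    · simp [Fin.sum_univ_three]
      linear_combination hn
    · simp only [Set.mem_ofPred_eq] at hz hz'
      simp [Fin.sum_univ_three]
      linear_combination hz - hz'
    · simp only [Set.mem_ofPred_eq] at hz
      change z 0 + 1 + G.1 * (z 1 + G.1) + G.2 * (z 2 + G.2) = -c
      linear_combination hz + hn
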